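/- (Proposition 5: consistency of the mean field game with the replicator dynamic in the myopic limit, exchangeable case.) Let Ū > 0, L_U > 0, and let U be a map assigning to each x ∈ Ω and each Borel probability measure m on Ω a real number U(x, m) such that 0 ≤ U(x, m) ≤ Ū for all x and m, and |U(x, m) − U(x, ν)| ≤ L_U · TV(m, ν) for all x and all Borel probability measures m, ν. Let μ₀ be a Borel probability measure on Ω. Let (δₙ) be a sequence of reals with δₙ > Ū for all n and δₙ → +∞, and suppose that for each n, mₙ is a Borel probability measure on Ω and Φₙ : Ω → ℝ is continuous with 0 ≤ Φₙ ≤ Ū on Ω, satisfying mₙ(A) = ∫_A δₙ / (δₙ − (Φₙ(x) − ∫_Ω Φₙ dmₙ)) μ₀(dx) for every Borel set A and Φₙ(x) = U(x, mₙ) + (1/(2δₙ)) ∫_Ω ((Φₙ(z) − Φₙ(x))₊)² mₙ(dz) for every x ∈ Ω. Then TV(mₙ, μ₀) → 0 and sup_{x ∈ Ω} |Φₙ(x) − U(x, μ₀)| → 0 as n → ∞. -/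

import Mathlib

open MeasureTheory Filter

/-- The action space `Ω = [0,1] ⊆ ℝ` with its Borel σ-algebra. -/
abbrev Ω : Type := Set.Icc (0:ℝ) 1

/-- Total variation distance between two (finite) Borel measures on `Ω`:
the total mass of the total variation of `μ − ν`, expressed via the Jordan
decomposition as `(μ − ν)(Ω) + (ν − μ)(Ω)` (truncated measure subtraction). -/
noncomputable def TV (μ ν : Measure Ω) : ℝ :=
  ((μ - ν) Set.univ + (ν - μ) Set.univ).toReal

lemma TV_le_aux (μ ν : Measure Ω) [IsProbabilityMeasure μ] [IsProbabilityMeasure ν]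
    (a b : ℝ) (ha : 0 ≤ a) (hb : 0 ≤ b)
    (h1 : ∀ A, MeasurableSet A → μ.real A ≤ (1 + a) * ν.real A)
    (h2 : ∀ A, MeasurableSet A → ν.real A ≤ (1 + b) * μ.real A) :
    TV μ ν ≤ a + b := by
  have key : ∀ (μ ν : Measure Ω) [IsProbabilityMeasure μ] [IsProbabilityMeasure ν]
      (a : ℝ) (_ : 0 ≤ a) (_ : ∀ A, MeasurableSet A → μ.real A ≤ (1 + a) * ν.real A),
      (μ - ν) Set.univ ≤ ENNReal.ofReal a := by
    intro μ ν _ _ a ha h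
    have hle : μ ≤ ENNReal.ofReal a • ν + ν := by
      refine Measure.le_iff.2 fun A hA => ?_
      have := h A hA
      rw [Measure.add_apply, Measure.smul_apply, smul_eq_mul,
        ← ofReal_measureReal (μ := μ), ← ofReal_measureReal (μ := ν),
        ← ENNReal.ofReal_mul ha, ← ENNReal.ofReal_add (by positivity) (by positivity)]
      exact ENNReal.ofReal_le_ofReal (by linarith)
    have h3 := Measure.sub_le_of_le_add hle Set.univ
    simpa using h3
  have k1 := key μ ν a ha h1
  have k2 := key ν μ b hb h2
  unfold TV
  refine ENNReal.toReal_le_of_le_ofReal (by positivity) ?_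
  rw [ENNReal.ofReal_add ha hb]
  exact add_le_add k1 k2

/-- **Proposition 5: consistency of the mean field game with the replicator
dynamic in the myopic limit `δ → ∞` (exchangeable case).** -/
theorem stmt9
    (Ubar LU : ℝ) (hUbar : 0 < Ubar) (hLU : 0 < LU)
    (U : Ω → Measure Ω → ℝ)
    (hUb : ∀ (x : Ω) (m : Measure Ω), IsProbabilityMeasure m →
      0 ≤ U x m ∧ U x m ≤ Ubar)
    (hUL : ∀ (x : Ω) (m ν : Measure Ω), IsProbabilityMeasure m →
      IsProbabilityMeasure ν → |U x m - U x ν| ≤ LU * TV m ν)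
    (μ0 : Measure Ω) [IsProbabilityMeasure μ0]
    (δ : ℕ → ℝ) (hδ : ∀ n, Ubar < δ n) (hδlim : Tendsto δ atTop atTop)
    (m : ℕ → Measure Ω) (hm : ∀ n, IsProbabilityMeasure (m n))
    (Φ : ℕ → Ω → ℝ) (hΦc : ∀ n, Continuous (Φ n))
    (hΦb : ∀ n x, 0 ≤ Φ n x ∧ Φ n x ≤ Ubar)
    (hFP : ∀ n, ∀ A : Set Ω, MeasurableSet A →
      m n A = ENNReal.ofReal
        (∫ x in A, δ n / (δ n - (Φ n x - ∫ z, Φ n z ∂(m n))) ∂μ0))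
    (hHJB : ∀ n, ∀ x : Ω, Φ n x = U x (m n) +
      (1 / (2 * δ n)) * ∫ z, (max (Φ n z - Φ n x) 0) ^ 2 ∂(m n)) :
    Tendsto (fun n => TV (m n) μ0) atTop (nhds 0) ∧
    Tendsto (fun n => ⨆ x : Ω, |Φ n x - U x μ0|) atTop (nhds 0) := by
  have hpos : ∀ n, 0 < δ n := fun n => hUbar.trans (hδ n)
  have hTV : ∀ n, TV (m n) μ0 ≤ Ubar / (δ n - Ubar) + Ubar / δ n := by
    intro n
    have := hm n
    have hd := hpos n
    have hd' : 0 < δ n - Ubar := sub_pos.2 (hδ n)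
    have hΦi : Integrable (Φ n) (m n) :=
      Integrable.of_bound (hΦc n).aestronglyMeasurable Ubar
        (Eventually.of_forall fun x => by
          rw [Real.norm_eq_abs, abs_of_nonneg (hΦb n x).1]; exact (hΦb n x).2)
    set I := ∫ z, Φ n z ∂(m n) with hI
    have hI0 : 0 ≤ I := integral_nonneg fun x => (hΦb n x).1
    have hI1 : I ≤ Ubar := by
      have := integral_mono hΦi (integrable_const Ubar) (fun x => (hΦb n x).2)
      simpa using this
    have hlow : ∀ x, δ n / (δ n + Ubar) ≤ δ n / (δ n - (Φ n x - I)) := fun x => by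
      have := hΦb n x
      exact div_le_div_of_nonneg_left hd.le (by linarith) (by linarith)
    have hup : ∀ x, δ n / (δ n - (Φ n x - I)) ≤ δ n / (δ n - Ubar) := fun x => by
      have := hΦb n x
      exact div_le_div_of_nonneg_left hd.le (by linarith) (by linarith)
    have hf0 : ∀ x, 0 ≤ δ n / (δ n - (Φ n x - I)) := fun x =>
      le_trans (by positivity) (hlow x)
    have hfi : Integrable (fun x => δ n / (δ n - (Φ n x - I))) μ0 := by
      refine Integrable.of_bound (C := δ n / (δ n - Ubar)) ?_ ?_
      · have := (hΦc n).measurable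
        exact Measurable.aestronglyMeasurable (by fun_prop)
      · exact Eventually.of_forall fun x => by
          rw [Real.norm_eq_abs, abs_of_nonneg (hf0 x)]; exact hup x
    have hmA : ∀ A, MeasurableSet A →
        (m n).real A = ∫ x in A, δ n / (δ n - (Φ n x - I)) ∂μ0 := by
      intro A hA
      rw [measureReal_def, hFP n A hA, ENNReal.toReal_ofReal]
      exact integral_nonneg hf0
    refine TV_le_aux (m n) μ0 _ _ (by positivity) (by positivity) ?_ ?_
    · intro A hA
      rw [hmA A hA]
      have h := integral_mono (μ := μ0.restrict A) hfi.integrableOn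
        (integrable_const (δ n / (δ n - Ubar))) hup
      have e : 1 + Ubar / (δ n - Ubar) = δ n / (δ n - Ubar) := by
        field_simp; ring
      rw [e]
      simpa [mul_comm] using h
    · intro A hA
      have h := integral_mono (μ := μ0.restrict A)
        (integrable_const (δ n / (δ n + Ubar))) hfi.integrableOn hlow
      rw [← hmA A hA] at h
      have h' : δ n / (δ n + Ubar) * μ0.real A ≤ (m n).real A := by
        simpa [mul_comm] using h
      have e : μ0.real A = (1 + Ubar / δ n) * (δ n / (δ n + Ubar) * μ0.real A) := by
        field_simp
      rw [e]
      exact mul_le_mul_of_nonneg_left h' (by positivity)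
  have hTV0 : ∀ n, 0 ≤ TV (m n) μ0 := fun n => ENNReal.toReal_nonneg
  have hlim : Tendsto (fun n => TV (m n) μ0) atTop (nhds 0) := by
    refine squeeze_zero hTV0 hTV ?_
    have a1 : Tendsto (fun n => Ubar / (δ n - Ubar)) atTop (nhds 0) :=
      Tendsto.const_div_atTop (tendsto_atTop_add_const_right _ (-Ubar) hδlim) Ubar
    have a2 : Tendsto (fun n => Ubar / δ n) atTop (nhds 0) :=
      Tendsto.const_div_atTop hδlim Ubar
    simpa using a1.add a2
  refine ⟨hlim, ?_⟩
  have hb : ∀ n x, |Φ n x - U x μ0| ≤ LU * TV (m n) μ0 + Ubar ^ 2 / 2 / δ n := by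
    intro n x
    have := hm n
    have hd := hpos n
    have h1 := hUL x (m n) μ0 (hm n) inferInstance
    have hsq : ∀ z, (max (Φ n z - Φ n x) 0) ^ 2 ≤ Ubar ^ 2 := fun z =>
      pow_le_pow_left₀ (le_max_right _ _)
        (max_le (by linarith [(hΦb n z).2, (hΦb n x).1]) hUbar.le) 2
    have hJ0 : 0 ≤ ∫ z, (max (Φ n z - Φ n x) 0) ^ 2 ∂(m n) :=
      integral_nonneg fun z => by positivity
    have hJ1 : ∫ z, (max (Φ n z - Φ n x) 0) ^ 2 ∂(m n) ≤ Ubar ^ 2 := by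
      have := integral_mono_of_nonneg (μ := m n) (Eventually.of_forall fun z => by positivity)
        (integrable_const (Ubar ^ 2)) (Eventually.of_forall hsq)
      simpa using this
    have h2 := hHJB n x
    set J := ∫ z, (max (Φ n z - Φ n x) 0) ^ 2 ∂(m n)
    have h3 : 0 ≤ 1 / (2 * δ n) * J := by positivity
    have h4 : 1 / (2 * δ n) * J ≤ Ubar ^ 2 / 2 / δ n := by
      calc 1 / (2 * δ n) * J ≤ 1 / (2 * δ n) * Ubar ^ 2 :=
            mul_le_mul_of_nonneg_left hJ1 (by positivity)
        _ = _ := by field_simp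
    rw [abs_le] at h1 ⊢
    constructor <;> linarith [h1.1, h1.2]
  refine squeeze_zero (fun n => Real.iSup_nonneg fun x => abs_nonneg _)
    (fun n => ciSup_le (hb n)) ?_
  have a2 : Tendsto (fun n => Ubar ^ 2 / 2 / δ n) atTop (nhds 0) :=
    Tendsto.const_div_atTop hδlim _
  simpa using (hlim.const_mul LU).add a2
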